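/- arXiv:1712.04866 — 3 statements merged into one kernel-verified Lean document; each statement's English description precedes it below -/
import Mathlib

section
/- Let 0 ≤ k ≤ n−1 and let f : Λ^k → ℝ. Then f is int. one affine if and only if there exist a_r ∈ Λ^{(n−k)r} for r = 0,…,⌊n/(n−k)⌋ such that f(ω) = Σ_{r=0}^{⌊n/(n−k)⌋} ⟨a_r; (∗ω)^r⟩ for all ω ∈ Λ^k, where (∗ω)^r denotes the r-fold exterior power of the Hodge dual of ω. -/
/-! Basic setup: `Λᵏ(ℝⁿ)` in coordinates with respect to the standard basis
`e^I`, `I` a strictly increasing multi-index (modeled as a `k`-element subset of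
`Fin n`), together with the exterior product, interior product, inner product,
Hodge star, and the various notions of one-directional convexity/affinity. -/

/-- Increasing multi-indices of length `k` in `{1,…,n}`: `k`-element subsets of `Fin n`.
`Idx n k` plays the role of `T_k`. -/
abbrev Idx (n k : ℕ) := {s : Finset (Fin n) // s.card = k}

/-- `Λᵏ(ℝⁿ)`, identified with its coordinates in the standard basis `e^I`. -/
abbrev Lam (n k : ℕ) := Idx n k → ℝ

/-- The sign `sgn(R,S)` defined by `e^{[R,S]} = sgn(R,S) e^R ∧ e^S` for disjoint
increasing multi-indices: `(-1)` to the number of inversions between `R` and `S`. -/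
def msign {n : ℕ} (R S : Finset (Fin n)) : ℝ :=
  (-1 : ℝ) ^ (((R ×ˢ S).filter (fun p => p.2 < p.1)).card)

/-- The basis form `e^S` (of degree `k = S.card`; zero if `k ≠ S.card`). -/
def bform {n k : ℕ} (S : Finset (Fin n)) : Lam n k :=
  fun I => if I.1 = S then 1 else 0

/-- Exterior (wedge) product in coordinates.  When `m = k + l` this is the wedge
product `Λᵏ × Λˡ → Λ^{k+l}`; for other `m` it is `0`. -/
def wedge {n k l m : ℕ} (ω : Lam n k) (φ : Lam n l) : Lam n m :=
  fun I => ∑ R : Idx n k, ∑ S : Idx n l,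
    if R.1 ∪ S.1 = I.1 ∧ Disjoint R.1 S.1 then msign R.1 S.1 * (ω R * φ S) else 0

/-- Interior product `a ⌟ b`, characterized by `⟨a ⌟ b; c⟩ = ⟨b; a ∧ c⟩`.  When
`m = k - j` this is the interior product `Λʲ × Λᵏ → Λ^{k-j}`; for other `m` it is `0`. -/
def iprod {n j k m : ℕ} (a : Lam n j) (b : Lam n k) : Lam n m :=
  fun C => ∑ A : Idx n j, ∑ B : Idx n k,
    if A.1 ∪ C.1 = B.1 ∧ Disjoint A.1 C.1 then msign A.1 C.1 * (a A * b B) else 0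

/-- Hodge star with respect to the standard orientation; when `m = n - k` this is
`∗ : Λᵏ → Λ^{n-k}`. -/
def hstar {n k m : ℕ} (ω : Lam n k) : Lam n m :=
  fun J => ∑ I : Idx n k, if I.1 = (J.1)ᶜ then msign I.1 J.1 * ω I else 0

/-- Inner product `⟨·;·⟩` on `Λᵏ` (the basis `e^I` is orthonormal). -/
def ip {n k : ℕ} (ω α : Lam n k) : ℝ := ∑ I : Idx n k, ω I * α I

/-- `s`-fold exterior power `ω^s = ω ∧ ⋯ ∧ ω` (with `ω^0 = 1 ∈ Λ⁰`). -/
def lpow {n k : ℕ} (ω : Lam n k) : (s : ℕ) → Lam n (k * s)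
  | 0 => bform ∅
  | s + 1 => wedge ω (lpow ω s)

/-- `f : Λᵏ → ℝ` is ext. one convex. -/
def ExtOneConvex {n k : ℕ} (f : Lam n k → ℝ) : Prop :=
  ∀ (ω : Lam n k) (a : Lam n 1) (b : Lam n (k-1)),
    ConvexOn ℝ Set.univ (fun t : ℝ => f (ω + t • (wedge a b : Lam n k)))

/-- `f : Λᵏ → ℝ` is ext. one affine. -/
def ExtOneAffine {n k : ℕ} (f : Lam n k → ℝ) : Prop :=
  ExtOneConvex f ∧ ExtOneConvex (fun ω => -f ω)

/-- `f : Λᵏ → ℝ` is int. one convex. -/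
def IntOneConvex {n k : ℕ} (f : Lam n k → ℝ) : Prop :=
  ∀ (ω : Lam n k) (a : Lam n 1) (b : Lam n (k+1)),
    ConvexOn ℝ Set.univ (fun t : ℝ => f (ω + t • (iprod a b : Lam n k)))

/-- `f : Λᵏ → ℝ` is int. one affine. -/
def IntOneAffine {n k : ℕ} (f : Lam n k → ℝ) : Prop :=
  IntOneConvex f ∧ IntOneConvex (fun ω => -f ω)

/-- `f : Λ^{k+1} × Λ^{k-1} → ℝ` is ext-int. one convex. -/
def ExtIntOneConvex {n k : ℕ} (f : Lam n (k+1) → Lam n (k-1) → ℝ) : Prop :=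
  ∀ (ξ : Lam n (k+1)) (η : Lam n (k-1)) (a : Lam n 1) (b : Lam n k),
    ConvexOn ℝ Set.univ
      (fun t : ℝ => f (ξ + t • (wedge a b : Lam n (k+1))) (η + t • (iprod a b : Lam n (k-1))))

/-- `f : Λ^{k+1} × Λ^{k-1} → ℝ` is ext-int. one affine. -/
def ExtIntOneAffine {n k : ℕ} (f : Lam n (k+1) → Lam n (k-1) → ℝ) : Prop :=
  ExtIntOneConvex f ∧ ExtIntOneConvex (fun ξ η => -f ξ η)

/-- `g : Λᵏ → ℝ` is affine, i.e. a constant plus a linear functional. -/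
def AffineFn {n k : ℕ} (g : Lam n k → ℝ) : Prop :=
  ∃ (c : ℝ) (a : Lam n k), ∀ ω, g ω = c + ip a ω


/-! ### Signs -/

lemma msign_eq_prod {n : ℕ} (R S : Finset (Fin n)) :
    msign R S = ∏ p ∈ R, ∏ q ∈ S, if q < p then (-1 : ℝ) else 1 := by
  rw [msign, ← Finset.prod_product', Finset.prod_ite]
  simp

lemma msign_union_left {n : ℕ} {R S : Finset (Fin n)} (h : Disjoint R S) (T : Finset (Fin n)) :
    msign (R ∪ S) T = msign R T * msign S T := by
  simp only [msign_eq_prod, Finset.prod_union h]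

lemma msign_union_right {n : ℕ} {S T : Finset (Fin n)} (R : Finset (Fin n)) (h : Disjoint S T) :
    msign R (S ∪ T) = msign R S * msign R T := by
  simp only [msign_eq_prod, Finset.prod_union h, Finset.prod_mul_distrib]

lemma msign_mul_self {n : ℕ} (R S : Finset (Fin n)) : msign R S * msign R S = 1 := by
  rw [msign, ← mul_pow]
  simp

lemma msign_ne_zero {n : ℕ} (R S : Finset (Fin n)) : msign R S ≠ 0 := by
  intro h
  simpa [h] using msign_mul_self R S

lemma msign_mul_msign_comm {n : ℕ} {R S : Finset (Fin n)} (h : Disjoint R S) :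
    msign R S * msign S R = (-1) ^ (R.card * S.card) := by
  rw [msign_eq_prod, msign_eq_prod, Finset.prod_comm (s := S), ← Finset.prod_mul_distrib,
    pow_mul', ← Finset.prod_const]
  refine Finset.prod_congr rfl fun p hp => ?_
  rw [← Finset.prod_mul_distrib, ← Finset.prod_const]
  refine Finset.prod_congr rfl fun q hq => ?_
  have hne : p ≠ q := fun e => Finset.disjoint_left.1 h hp (e ▸ hq)
  rcases lt_or_gt_of_ne hne with h1 | h1 <;> simp [h1, not_lt.2 h1.le]

lemma msign_comm {n : ℕ} {R S : Finset (Fin n)} (h : Disjoint R S) :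
    msign R S = (-1) ^ (R.card * S.card) * msign S R := by
  rw [← msign_mul_msign_comm h, mul_assoc, msign_mul_self, mul_one]

@[simp] lemma msign_empty_left {n : ℕ} (S : Finset (Fin n)) : msign ∅ S = 1 := by
  simp [msign]

/-! ### Contraction operators -/

/-- Contraction by the basis form `e^R`, the adjoint of left exterior multiplication by it,
on coordinate functions of arbitrary degree. -/
def contr {n : ℕ} (R : Finset (Fin n)) : Module.End ℝ (Finset (Fin n) → ℝ) where
  toFun C J := if Disjoint R J then msign R J * C (R ∪ J) else 0
  map_add' C D := by
    ext J
    by_cases h : Disjoint R J <;> simp [h, mul_add]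
  map_smul' c C := by
    ext J
    by_cases h : Disjoint R J <;> simp [h, mul_left_comm]

lemma contr_apply {n : ℕ} (R : Finset (Fin n)) (C : Finset (Fin n) → ℝ) (J : Finset (Fin n)) :
    contr R C J = if Disjoint R J then msign R J * C (R ∪ J) else 0 := rfl

lemma contr_empty {n : ℕ} : contr (∅ : Finset (Fin n)) = 1 := by
  refine LinearMap.ext fun C => funext fun J => ?_
  simp [contr_apply]

lemma contr_mul_contr_of_disjoint {n : ℕ} {R S : Finset (Fin n)} (h : Disjoint R S) :
    contr S * contr R = msign R S • contr (R ∪ S) := by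
  refine LinearMap.ext fun C => funext fun J => ?_
  simp only [Module.End.mul_apply, LinearMap.smul_apply, Pi.smul_apply, contr_apply, smul_eq_mul,
    Finset.disjoint_union_left, Finset.disjoint_union_right, h, true_and]
  by_cases hS : Disjoint S J
  · by_cases hR : Disjoint R J
    · simp only [hS, hR, and_self, if_true]
      rw [msign_union_right R hS, msign_union_left h, Finset.union_assoc]
      ring
    · simp [hR]
  · simp [hS]

lemma contr_mul_contr_of_not_disjoint {n : ℕ} {R S : Finset (Fin n)} (h : ¬ Disjoint R S) :
    contr S * contr R = 0 := by
  refine LinearMap.ext fun C => funext fun J => ?_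
  simp [contr_apply, Finset.disjoint_union_right, h]

lemma contr_mul_comm {n : ℕ} (R S : Finset (Fin n)) :
    contr R * contr S = (-1 : ℝ) ^ (R.card * S.card) • (contr S * contr R) := by
  by_cases h : Disjoint R S
  · rw [contr_mul_contr_of_disjoint h, contr_mul_contr_of_disjoint h.symm, Finset.union_comm S R,
      smul_smul, msign_comm h.symm, mul_comm S.card]
  · rw [contr_mul_contr_of_not_disjoint h, contr_mul_contr_of_not_disjoint (fun h' => h h'.symm),
      smul_zero]

/-- Contraction by the form `ω`. -/
def contrForm {n k : ℕ} (ω : Lam n k) : Module.End ℝ (Finset (Fin n) → ℝ) :=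
  ∑ R : Idx n k, ω R • contr R.1

lemma contrForm_add {n k : ℕ} (ω φ : Lam n k) :
    contrForm (ω + φ) = contrForm ω + contrForm φ := by
  simp [contrForm, add_smul, Finset.sum_add_distrib]

lemma contrForm_smul {n k : ℕ} (t : ℝ) (ω : Lam n k) :
    contrForm (t • ω) = t • contrForm ω := by
  simp [contrForm, Finset.smul_sum, smul_smul]

lemma contrForm_mul_comm {n k l : ℕ} (a : Lam n k) (b : Lam n l) :
    contrForm a * contrForm b = (-1 : ℝ) ^ (k * l) • (contrForm b * contrForm a) := by
  simp only [contrForm, Finset.sum_mul_sum, Finset.smul_sum]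
  rw [Finset.sum_comm]
  refine Finset.sum_congr rfl fun S _ => Finset.sum_congr rfl fun R _ => ?_
  rw [smul_mul_smul_comm, smul_mul_smul_comm, contr_mul_comm, R.2, S.2, smul_comm, mul_comm (b S)]

lemma contrForm_mul_self {n : ℕ} (a : Lam n 1) : contrForm a * contrForm a = 0 := by
  have h := contrForm_mul_comm a a
  refine LinearMap.ext fun C => funext fun J => ?_
  have hJ := congrFun (LinearMap.congr_fun h C) J
  simp only [mul_one, pow_one, LinearMap.smul_apply, Pi.smul_apply, smul_eq_mul] at hJ
  simp only [LinearMap.zero_apply, Pi.zero_apply]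
  linarith

lemma sum_wedge_smul {n k l : ℕ} {M : Type*} [AddCommGroup M] [Module ℝ M] (a : Lam n k)
    (b : Lam n l) {m : ℕ} (hm : m = k + l) (F : Finset (Fin n) → M) :
    ∑ Q : Idx n m, (wedge a b : Lam n m) Q • F Q.1 = ∑ R : Idx n k, ∑ S : Idx n l,
      (a R * b S) • (if Disjoint R.1 S.1 then msign R.1 S.1 • F (R.1 ∪ S.1) else 0) := by
  simp only [wedge, Finset.sum_smul]
  rw [Finset.sum_comm]
  refine Finset.sum_congr rfl fun R _ => ?_
  rw [Finset.sum_comm]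
  refine Finset.sum_congr rfl fun S _ => ?_
  by_cases h : Disjoint R.1 S.1
  · have hc : (R.1 ∪ S.1).card = m := by rw [Finset.card_union_of_disjoint h, R.2, S.2, hm]
    rw [Finset.sum_eq_single (⟨R.1 ∪ S.1, hc⟩ : Idx n m)]
    · simp [h, smul_smul, mul_comm]
    · intro Q _ hQ
      have : R.1 ∪ S.1 ≠ Q.1 := fun e => hQ (Subtype.ext e.symm)
      simp [this]
    · simp
  · simp [h]

lemma contrForm_wedge {n k l m : ℕ} (hm : m = k + l) (a : Lam n k) (b : Lam n l) :
    contrForm (wedge a b : Lam n m) = contrForm b * contrForm a := by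
  rw [contrForm, sum_wedge_smul a b hm (F := contr), contrForm, contrForm, Finset.sum_mul_sum, Finset.sum_comm]
  refine Finset.sum_congr rfl fun S _ => Finset.sum_congr rfl fun R _ => ?_
  rw [smul_mul_smul_comm, mul_comm (b S)]
  split_ifs with h
  · rw [contr_mul_contr_of_disjoint h]
  · rw [contr_mul_contr_of_not_disjoint h]

lemma contrForm_lpow {n k : ℕ} (ω : Lam n k) (r : ℕ) :
    contrForm (lpow ω r) = contrForm ω ^ r := by
  induction r with
  | zero =>
    rw [contrForm, Finset.sum_eq_single (⟨∅, by simp⟩ : Idx n (k * 0))]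
    · simp [lpow, bform, contr_empty]
    · intro R _ hR
      have : R.1 ≠ ∅ := fun e => hR (Subtype.ext e)
      simp [lpow, bform, this]
    · simp
  | succ r ih =>
    rw [lpow, contrForm_wedge (by ring), ih, pow_succ]

/-- Extension by zero of a form to a function on all multi-indices. -/
def extendForm {n k : ℕ} (c : Lam n k) : Finset (Fin n) → ℝ :=
  fun S => if h : S.card = k then c ⟨S, h⟩ else 0

lemma contrForm_apply_empty {n k : ℕ} (x : Lam n k) (C : Finset (Fin n) → ℝ) :
    contrForm x C ∅ = ip (fun S => C S.1) x := by
  simp [contrForm, ip, contr_apply, msign, mul_comm]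

lemma ip_lpow_eq {n k r : ℕ} (c : Lam n (k * r)) (ω : Lam n k) :
    ip c (lpow ω r) = (contrForm ω ^ r) (extendForm c) ∅ := by
  rw [← contrForm_lpow, contrForm_apply_empty]
  congr 1
  ext S
  simp [extendForm, S.2]

lemma exists_add_smul_pow_eq {A : Type*} [Ring A] [Algebra ℝ A] {a b x : A} {e e' : ℝ}
    (haa : a * a = 0) (hab : a * b = e • (b * a)) (hax : a * x = e' • (x * a)) (r : ℕ) :
    ∃ z : A, ∀ t : ℝ, (x + t • (b * a)) ^ r = x ^ r + t • (z * a) := by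
  induction r with
  | zero => exact ⟨0, by simp⟩
  | succ r ih =>
    obtain ⟨z, hz⟩ := ih
    refine ⟨e' • (z * x) + x ^ r * b, fun t => ?_⟩
    have h1 : z * a * (b * a) = 0 := by
      rw [mul_assoc, ← mul_assoc a, hab, smul_mul_assoc, mul_assoc b, haa]
      simp
    have h2 : z * a * x = e' • (z * x * a) := by
      rw [mul_assoc, hax, mul_smul_comm, mul_assoc]
    rw [pow_succ, hz, pow_succ, add_mul, mul_add, mul_add, smul_mul_smul_comm, h1, smul_mul_assoc,
      h2, add_mul, smul_mul_assoc, mul_smul_comm, mul_assoc (x ^ r)]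
    simp only [smul_zero, add_zero, smul_add]
    abel

lemma exists_ip_lpow_add_smul_wedge {n m r : ℕ} (hm : 1 ≤ m) (c : Lam n (m * r)) (φ : Lam n m)
    (a : Lam n 1) (b : Lam n (m - 1)) :
    ∃ q : ℝ, ∀ t : ℝ, ip c (lpow (φ + t • (wedge a b : Lam n m)) r) = ip c (lpow φ r) + t * q := by
  obtain ⟨z, hz⟩ := exists_add_smul_pow_eq (contrForm_mul_self a) (contrForm_mul_comm a b)
    (contrForm_mul_comm a φ) r
  refine ⟨(z * contrForm a) (extendForm c) ∅, fun t => ?_⟩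
  rw [ip_lpow_eq, ip_lpow_eq, contrForm_add, contrForm_smul, contrForm_wedge (by omega), hz]
  simp

/-! ### The Hodge star and interior products -/

/-- The inverse of the Hodge star `hstar : Lam n k → Lam n m`. -/
def hstarInv {n k m : ℕ} (h : k + m = n) : Lam n m →ₗ[ℝ] Lam n k where
  toFun φ I := msign I.1 I.1ᶜ * φ ⟨I.1ᶜ, by rw [Finset.card_compl, I.2, Fintype.card_fin]; omega⟩
  map_add' φ ψ := by ext; simp [mul_add]
  map_smul' c φ := by ext; simp [mul_left_comm]

lemma hstar_apply {n k m : ℕ} (h : k + m = n) (ω : Lam n k) (J : Idx n m) :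
    (hstar ω : Lam n m) J = msign J.1ᶜ J.1 *
      ω ⟨J.1ᶜ, by rw [Finset.card_compl, J.2, Fintype.card_fin]; omega⟩ := by
  have hc : (J.1ᶜ).card = k := by rw [Finset.card_compl, J.2, Fintype.card_fin]; omega
  rw [hstar, Finset.sum_eq_single (⟨J.1ᶜ, hc⟩ : Idx n k)]
  · simp
  · intro I _ hI
    have : I.1 ≠ J.1ᶜ := fun e => hI (Subtype.ext e)
    simp [this]
  · simp

lemma hstar_hstarInv {n k m : ℕ} (h : k + m = n) (φ : Lam n m) :
    (hstar (hstarInv h φ) : Lam n m) = φ := by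
  ext J
  simp [hstar_apply h, hstarInv, ← mul_assoc, msign_mul_self]

lemma hstarInv_hstar {n k m : ℕ} (h : k + m = n) (ω : Lam n k) :
    hstarInv h (hstar ω : Lam n m) = ω := by
  ext I
  simp [hstar_apply h, hstarInv, ← mul_assoc, msign_mul_self]

lemma hstarInv_wedge {n k m p : ℕ} (h : k + m = n) (hp : m = 1 + p) (h' : k + 1 + p = n)
    (a : Lam n 1) (b : Lam n p) :
    hstarInv h (wedge a b : Lam n m) = iprod a ((-1 : ℝ) ^ k • hstarInv h' b) := by
  ext C
  simp only [hstarInv, LinearMap.coe_mk, AddHom.coe_mk, wedge, iprod, Finset.mul_sum, Pi.smul_apply,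
    smul_eq_mul]
  refine Finset.sum_congr rfl fun R _ => ?_
  have hR := R.2
  have hC := C.2
  by_cases hd : Disjoint R.1 C.1
  · have hcB : (R.1 ∪ C.1).card = k + 1 := by
      rw [Finset.card_union_of_disjoint hd, hR, hC, add_comm]
    have hcS : ((R.1 ∪ C.1)ᶜ).card = p := by
      rw [Finset.card_compl, hcB, Fintype.card_fin]; omega
    have hRS : Disjoint R.1 (R.1 ∪ C.1)ᶜ :=
      Finset.disjoint_left.2 fun x hx hx' => by simp [hx] at hx'
    have hCS : Disjoint C.1 (R.1 ∪ C.1)ᶜ :=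
      Finset.disjoint_left.2 fun x hx hx' => by simp [hx] at hx'
    have hU : R.1 ∪ (R.1 ∪ C.1)ᶜ = C.1ᶜ := by
      ext x
      have h1 : x ∈ R.1 → x ∉ C.1 := fun hx => Finset.disjoint_left.1 hd hx
      simp only [Finset.mem_union, Finset.mem_compl]
      tauto
    rw [Finset.sum_eq_single (⟨(R.1 ∪ C.1)ᶜ, hcS⟩ : Idx n p),
      Finset.sum_eq_single (⟨R.1 ∪ C.1, hcB⟩ : Idx n (k + 1))]
    · simp only [hU, hd, hRS, and_self, if_true]
      rw [← hU, msign_union_right _ hRS, msign_union_left hd, msign_comm hd.symm, hR, hC, mul_one]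
      ring
    · intro B _ hB
      have : R.1 ∪ C.1 ≠ B.1 := fun e => hB (Subtype.ext e.symm)
      simp [this]
    · simp
    · intro S _ hS
      rw [if_neg, mul_zero]
      rintro ⟨e, hRS'⟩
      refine hS (Subtype.ext ?_)
      ext x
      have h1 : x ∈ R.1 → x ∉ S.1 := fun hx => Finset.disjoint_left.1 hRS' hx
      have h2 : (x ∈ R.1 ∨ x ∈ S.1) ↔ x ∉ C.1 := by
        rw [← Finset.mem_union, e, Finset.mem_compl]
      have h3 : x ∈ R.1 → x ∉ C.1 := fun hx => Finset.disjoint_left.1 hd hx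
      simp only [Finset.mem_union, Finset.mem_compl]
      tauto
    · simp
  · rw [Finset.sum_eq_zero, Finset.sum_eq_zero]
    · intro B _
      simp [hd]
    · intro S _
      rw [if_neg, mul_zero]
      rintro ⟨e, -⟩
      refine hd (Finset.disjoint_left.2 fun x hx => ?_)
      rw [← Finset.mem_compl, ← e]
      exact Finset.mem_union_left _ hx

/-! ### Finite differences of functions that are affine along decomposable directions -/

/-- `g` is affine on every line of direction `y`. -/
def AffineAlong {E : Type*} [AddCommGroup E] [Module ℝ E] (g : E → ℝ) (y : E) : Prop :=
  ∀ (x : E) (t : ℝ), g (x + t • y) = g x + t * (g (x + y) - g x)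

/-- The finite difference operator in direction `y`. -/
def findiff {E : Type*} [AddCommGroup E] (y : E) : Module.End ℝ (E → ℝ) where
  toFun g x := g (x + y) - g x
  map_add' g h := by
    ext x
    simp only [Pi.add_apply]
    ring
  map_smul' c g := by
    ext x
    simp only [Pi.smul_apply, smul_eq_mul, RingHom.id_apply]
    ring

lemma findiff_apply {E : Type*} [AddCommGroup E] (y : E) (g : E → ℝ) (x : E) : findiff y g x = g (x + y) - g x := rfl

lemma findiff_comm {E : Type*} [AddCommGroup E] (y z : E) (g : E → ℝ) :
    findiff y (findiff z g) = findiff z (findiff y g) := by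
  ext x
  simp only [findiff_apply, add_right_comm x y z]
  ring

section AffineAlong

variable {E : Type*} [AddCommGroup E] [Module ℝ E] {g : E → ℝ} {y z : E}

lemma AffineAlong.findiff (hg : AffineAlong g y) (z : E) : AffineAlong (findiff z g) y := by
  intro x t
  simp only [findiff_apply, add_right_comm x _ z, hg x t, hg (x + z) t]
  ring

lemma findiff_findiff_eq_zero (hy : AffineAlong g y) (hz : AffineAlong g z)
    (hyz : AffineAlong g (y + z)) : findiff y (findiff z g) = 0 := by
  ext x
  have h1 := hyz x 2
  have h2 := hz (x + (2 : ℝ) • y) 2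
  have h3 := hy (x + z) 2
  have h4 := hy x 2
  rw [add_assoc, ← smul_add] at h2
  rw [add_right_comm, add_right_comm x z y] at h3
  rw [← add_assoc] at h1
  simp only [findiff_apply, Pi.zero_apply]
  linarith

lemma findiff_add (hy : AffineAlong g y) (hz : AffineAlong g z) (hyz : AffineAlong g (y + z)) :
    findiff (y + z) g = findiff y g + findiff z g := by
  ext x
  have h := congrFun (findiff_findiff_eq_zero hy hz hyz) x
  simp only [findiff_apply, Pi.zero_apply, Pi.add_apply, ← add_assoc] at h ⊢
  linarith

lemma findiff_smul (hy : AffineAlong g y) (t : ℝ) : findiff (t • y) g = t • findiff y g := by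
  ext x
  simp [findiff_apply, hy x t]

end AffineAlong

lemma wedge_add_left {n k l m : ℕ} (a a' : Lam n k) (b : Lam n l) :
    (wedge (a + a') b : Lam n m) = wedge a b + wedge a' b := by
  ext I
  simp only [wedge, Pi.add_apply, ← Finset.sum_add_distrib]
  refine Finset.sum_congr rfl fun R _ => Finset.sum_congr rfl fun S _ => ?_
  split_ifs <;> ring

lemma wedge_add_right {n k l m : ℕ} (a : Lam n k) (b b' : Lam n l) :
    (wedge a (b + b') : Lam n m) = wedge a b + wedge a b' := by
  ext I
  simp only [wedge, Pi.add_apply, ← Finset.sum_add_distrib]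
  refine Finset.sum_congr rfl fun R _ => Finset.sum_congr rfl fun S _ => ?_
  split_ifs <;> ring

lemma wedge_smul_right {n k l m : ℕ} (a : Lam n k) (t : ℝ) (b : Lam n l) :
    (wedge a (t • b) : Lam n m) = t • wedge a b := by
  ext I
  simp only [wedge, Pi.smul_apply, smul_eq_mul, Finset.mul_sum]
  refine Finset.sum_congr rfl fun R _ => Finset.sum_congr rfl fun S _ => ?_
  split_ifs <;> ring

lemma wedge_bform {n k l m : ℕ} {R S : Finset (Fin n)} (hR : R.card = k) (hS : S.card = l)
    (h : Disjoint R S) :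
    (wedge (bform R : Lam n k) (bform S : Lam n l) : Lam n m) = msign R S • bform (R ∪ S) := by
  ext I
  rw [wedge, Finset.sum_eq_single (⟨R, hR⟩ : Idx n k), Finset.sum_eq_single (⟨S, hS⟩ : Idx n l)]
  · simp [bform, h, eq_comm]
  · intro T _ hT
    have : T.1 ≠ S := fun e => hT (Subtype.ext e)
    simp [bform, this]
  · simp
  · intro T _ hT
    have : T.1 ≠ R := fun e => hT (Subtype.ext e)
    simp [bform, this]
  · simp

/-- `g` is affine on every line whose direction is divisible by a `1`-form. -/
def WedgeAffine {n m : ℕ} (g : Lam n m → ℝ) : Prop :=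
  ∀ (a : Lam n 1) (b : Lam n (m - 1)), AffineAlong g (wedge a b)

lemma bform_eq_smul_wedge {n m : ℕ} {i : Fin n} {B : Finset (Fin n)} (hi : i ∉ B)
    (hB : (insert i B).card = m) :
    (bform (insert i B) : Lam n m) =
      msign {i} B • wedge (bform {i} : Lam n 1) (bform B : Lam n (m - 1)) := by
  rw [Finset.card_insert_of_notMem hi] at hB
  rw [wedge_bform (by simp) (by omega) (by simpa using hi), smul_smul, msign_mul_self, one_smul,
    Finset.insert_eq]

lemma exists_bform_eq_wedge {n m : ℕ} {i : Fin n} {I : Finset (Fin n)} (hi : i ∈ I)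
    (hI : I.card = m) :
    ∃ b : Lam n (m - 1), (bform I : Lam n m) = wedge (bform {i} : Lam n 1) b := by
  refine ⟨msign {i} (I.erase i) • bform (I.erase i), ?_⟩
  have h := bform_eq_smul_wedge (Finset.notMem_erase i I) (m := m)
    (by rw [Finset.insert_erase hi, hI])
  rw [Finset.insert_erase hi] at h
  rw [wedge_smul_right, h]

namespace WedgeAffine

variable {n m : ℕ} {g : Lam n m → ℝ}

lemma findiff (hg : WedgeAffine g) (y : Lam n m) : WedgeAffine (findiff y g) :=
  fun a b => (hg a b).findiff y

lemma affineAlong_bform (hg : WedgeAffine g) {I : Finset (Fin n)} (hI : I.Nonempty)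
    (hIm : I.card = m) : AffineAlong g (bform I) := by
  obtain ⟨i, hi⟩ := hI
  obtain ⟨b, hb⟩ := exists_bform_eq_wedge hi hIm
  exact hb ▸ hg _ b

lemma findiff_wedge_wedge_same (hg : WedgeAffine g) (a : Lam n 1) (b b' : Lam n (m - 1)) :
    _root_.findiff (wedge a b) (_root_.findiff (wedge a b') g) = 0 :=
  findiff_findiff_eq_zero (hg a b) (hg a b') (wedge_add_right a b b' ▸ hg a (b + b'))

lemma findiff_wedge_add_left (hg : WedgeAffine g) (a a' : Lam n 1) (b : Lam n (m - 1)) :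
    _root_.findiff (wedge (a + a') b) g =
      _root_.findiff (wedge a b) g + _root_.findiff (wedge a' b) g := by
  rw [wedge_add_left]
  exact findiff_add (hg a b) (hg a' b) (wedge_add_left a a' b ▸ hg (a + a') b)

lemma findiff_wedge_swap (hg : WedgeAffine g) (a a' : Lam n 1) (b b' : Lam n (m - 1)) :
    _root_.findiff (wedge a b) (_root_.findiff (wedge a' b') g) =
      -_root_.findiff (wedge a' b) (_root_.findiff (wedge a b') g) := by
  have h := hg.findiff_wedge_wedge_same (a + a') b b'
  rw [(hg.findiff _).findiff_wedge_add_left, hg.findiff_wedge_add_left, map_add, map_add,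
    hg.findiff_wedge_wedge_same, hg.findiff_wedge_wedge_same, zero_add, add_zero] at h
  exact eq_neg_of_add_eq_zero_left h

lemma findiff_bform_bform_of_mem (hg : WedgeAffine g) {i : Fin n} {I J : Finset (Fin n)}
    (hI : I.card = m) (hJ : J.card = m) (hiI : i ∈ I) (hiJ : i ∈ J) :
    _root_.findiff (bform I) (_root_.findiff (bform J) g) = 0 := by
  obtain ⟨b, hb⟩ := exists_bform_eq_wedge hiI hI
  obtain ⟨b', hb'⟩ := exists_bform_eq_wedge hiJ hJ
  rw [hb, hb', hg.findiff_wedge_wedge_same]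

lemma findiff_bform_insert (hg : WedgeAffine g) {i : Fin n} {B : Finset (Fin n)} (hi : i ∉ B)
    (hB : (insert i B).card = m) :
    _root_.findiff (bform (insert i B)) g = msign {i} B •
      _root_.findiff (wedge (bform {i} : Lam n 1) (bform B : Lam n (m - 1))) g := by
  rw [bform_eq_smul_wedge hi hB, findiff_smul (hg _ _)]

lemma findiff_bform_swap (hg : WedgeAffine g) {i j : Fin n} {B B' : Finset (Fin n)}
    (hiB : i ∉ B) (hiB' : i ∉ B') (hjB : j ∉ B) (hjB' : j ∉ B')
    (hB : B.card + 1 = m) (hB' : B'.card + 1 = m) :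
    (msign {i} B * msign {j} B') •
        _root_.findiff (bform (insert i B)) (_root_.findiff (bform (insert j B')) g) =
      -((msign {j} B * msign {i} B') •
        _root_.findiff (bform (insert j B)) (_root_.findiff (bform (insert i B')) g)) := by
  have hc : ∀ {x : Fin n} {A : Finset (Fin n)}, x ∉ A → A.card + 1 = m → (insert x A).card = m :=
    fun hx hA => by rw [Finset.card_insert_of_notMem hx, hA]
  rw [(hg.findiff _).findiff_bform_insert hiB (hc hiB hB),
    (hg.findiff _).findiff_bform_insert hjB (hc hjB hB),
    hg.findiff_bform_insert hjB' (hc hjB' hB'), hg.findiff_bform_insert hiB' (hc hiB' hB'),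
    map_smul, map_smul, smul_smul, smul_smul, smul_smul, smul_smul,
    hg.findiff_wedge_swap (bform {i}) (bform {j})]
  rw [show msign {i} B * msign {j} B' * msign {i} B * msign {j} B' =
      (msign {i} B * msign {i} B) * (msign {j} B' * msign {j} B') by ring,
    show msign {j} B * msign {i} B' * msign {j} B * msign {i} B' =
      (msign {j} B * msign {j} B) * (msign {i} B' * msign {i} B') by ring]
  simp [msign_mul_self]

end WedgeAffine

/-! ### Higher differences at the origin as iterated contractions -/

/-- The `r`-fold differences of `g` at the origin along basis forms are the `r`-fold contractions
of `C` by these basis forms. -/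
def Represents {n m : ℕ} : ℕ → (Lam n m → ℝ) → (Finset (Fin n) → ℝ) → Prop
  | 0, g, C => g 0 = C ∅
  | r + 1, g, C => ∀ I : Finset (Fin n), I.card = m →
      Represents r (findiff (bform I) g) (contr I C)

namespace Represents

variable {n m : ℕ}

lemma congr {r : ℕ} {g : Lam n m → ℝ} {C D : Finset (Fin n) → ℝ} (h : Represents r g C)
    (hCD : ∀ S : Finset (Fin n), S.card = m * r → C S = D S) : Represents r g D := by
  induction r generalizing g C D with
  | zero =>
    rw [Represents] at h ⊢
    rw [h, hCD ∅ (by simp)]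
  | succ r ih =>
    intro I hI
    refine ih (h I hI) fun S hS => ?_
    simp only [contr_apply]
    split_ifs with hd
    · rw [hCD _ (by rw [Finset.card_union_of_disjoint hd, hI, hS]; ring)]
    · rfl

lemma add {r : ℕ} {g h : Lam n m → ℝ} {C D : Finset (Fin n) → ℝ} (hg : Represents r g C)
    (hh : Represents r h D) : Represents r (g + h) (C + D) := by
  induction r generalizing g h C D with
  | zero =>
    rw [Represents] at hg hh ⊢
    simp [hg, hh]
  | succ r ih =>
    intro I hI
    rw [map_add, map_add]
    exact ih (hg I hI) (hh I hI)

lemma smul {r : ℕ} {g : Lam n m → ℝ} {C : Finset (Fin n) → ℝ} (c : ℝ) (hg : Represents r g C) :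
    Represents r (c • g) (c • C) := by
  induction r generalizing g C with
  | zero =>
    rw [Represents] at hg ⊢
    simp [hg]
  | succ r ih =>
    intro I hI
    rw [map_smul, map_smul]
    exact ih (hg I hI)

lemma eq_zero {r : ℕ} {C : Finset (Fin n) → ℝ} (h : Represents r (0 : Lam n m → ℝ) C)
    {S : Finset (Fin n)} (hS : S.card = m * r) : C S = 0 := by
  induction r generalizing C S with
  | zero =>
    have : S = ∅ := by simpa using hS
    rw [this]
    exact h.symm
  | succ r ih =>
    obtain ⟨I, hIS, hI⟩ := Finset.exists_subset_card_eq (s := S) (n := m) (by rw [hS]; nlinarith)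
    have h' := h I hI
    rw [map_zero] at h'
    have h0 := ih h' (S := S \ I) (by
      rw [Finset.card_sdiff_of_subset hIS, hS, hI, mul_add, mul_one, Nat.add_sub_cancel])
    rw [contr_apply, if_pos Finset.disjoint_sdiff, Finset.union_sdiff_of_subset hIS] at h0
    exact (mul_eq_zero.1 h0).resolve_left (msign_ne_zero _ _)

end Represents

lemma exists_block_of_mem {n m r : ℕ} (hm : 1 ≤ m) {J : Finset (Fin n)} {j : Fin n} (hj : j ∈ J)
    (hJ : J.card = m * r) :
    ∃ (s : ℕ) (A T : Finset (Fin n)), r = s + 1 ∧ j ∈ A ∧ A.card = m ∧ T.card = m * s ∧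
      Disjoint A T ∧ J = A ∪ T := by
  obtain _ | s := r
  · simp only [mul_zero, Finset.card_eq_zero] at hJ
    simp [hJ] at hj
  · obtain ⟨A, hjA, hAJ, hA⟩ := Finset.exists_subsuperset_card_eq (n := m)
      (Finset.singleton_subset_iff.2 hj) (by simpa using hm) (by rw [hJ]; nlinarith)
    refine ⟨s, A, J \ A, rfl, Finset.singleton_subset_iff.1 hjA, hA, ?_, Finset.disjoint_sdiff,
      (Finset.union_sdiff_of_subset hAJ).symm⟩
    rw [Finset.card_sdiff_of_subset hAJ, hJ, hA, mul_add, mul_one, Nat.add_sub_cancel]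

section Exchange

variable {n m r : ℕ} {g : Lam n m → ℝ} {K : Finset (Fin n) → Finset (Fin n) → ℝ}

lemma represents_eq_zero_of_mem (hm : 1 ≤ m) (hg : WedgeAffine g)
    (hK : ∀ I, Represents r (findiff (bform I) g) (K I)) {I J : Finset (Fin n)} {j : Fin n}
    (hI : I.card = m) (hJ : J.card = m * r) (hjI : j ∈ I) (hjJ : j ∈ J) : K I J = 0 := by
  obtain ⟨s, A, T, rfl, hjA, hA, hT, hAT, rfl⟩ := exists_block_of_mem hm hjJ hJ
  have h := hK I A hA
  rw [hg.findiff_bform_bform_of_mem hA hI hjA hjI] at h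
  have h0 := h.eq_zero hT
  rw [contr_apply, if_pos hAT] at h0
  exact (mul_eq_zero.1 h0).resolve_left (msign_ne_zero _ _)

lemma represents_exchange (hm : 1 ≤ m) (hg : WedgeAffine g)
    (hK : ∀ I, Represents r (findiff (bform I) g) (K I)) {B D : Finset (Fin n)} {i j : Fin n}
    (hB : B.card + 1 = m) (hD : D.card + 1 = m * r) (hiB : i ∉ B) (hjB : j ∉ B)
    (hiD : i ∉ D) (hjD : j ∉ D) :
    msign {i} B * msign {j} D * K (insert i B) (insert j D) =
      -(msign {j} B * msign {i} D * K (insert j B) (insert i D)) := by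
  obtain ⟨s, A, T, rfl, hjA, hA, hT, hAT, hDA⟩ := exists_block_of_mem hm
    (Finset.mem_insert_self j D) (by rw [Finset.card_insert_of_notMem hjD, hD])
  set A' := A.erase j with hA'
  have hAj : A = insert j A' := (Finset.insert_erase hjA).symm
  have hjA' : j ∉ A' := Finset.notMem_erase j A
  have hjT : j ∉ T := Finset.disjoint_left.1 hAT hjA
  have hA'T : Disjoint A' T := Finset.disjoint_of_subset_left (Finset.erase_subset _ _) hAT
  have hDU : D = A' ∪ T := by
    rw [← Finset.erase_insert hjD, hDA, Finset.erase_union_distrib, Finset.erase_eq_of_notMem hjT]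
  have hiA' : i ∉ A' := fun h => hiD (hDU ▸ Finset.mem_union_left _ h)
  have hiT : i ∉ T := fun h => hiD (hDU ▸ Finset.mem_union_right _ h)
  have hcA' : A'.card + 1 = m := by rw [← hA, hAj, Finset.card_insert_of_notMem hjA']
  have hciA : (insert i A').card = m := by rw [Finset.card_insert_of_notMem hiA', hcA']
  have hiAT : Disjoint (insert i A') T := by
    rw [Finset.disjoint_insert_left]
    exact ⟨hiT, hA'T⟩
  have h1 := (hK (insert i B) A hA).smul (msign {i} B * msign {j} A')
  have h2 := (hK (insert j B) (insert i A') hciA).smul (msign {j} B * msign {i} A')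
  have h3 := h1.add h2
  rw [hAj, findiff_comm (bform (insert j A')), findiff_comm (bform (insert i A')),
    hg.findiff_bform_swap hiB hiA' hjB hjA' hB hcA', neg_add_cancel] at h3
  have h4 := h3.eq_zero hT
  have hiT' : Disjoint {i} A' := by simpa using hiA'
  have hjT' : Disjoint {j} A' := by simpa using hjA'
  simp only [Pi.add_apply, Pi.smul_apply, smul_eq_mul, contr_apply, hiAT, ← hAj, hAT, if_true] at h4
  rw [← hDA, hAj, Finset.insert_eq j A', Finset.insert_eq i A', msign_union_left hjT',
    msign_union_left hiT', Finset.union_assoc {i}, ← hDU, ← Finset.insert_eq i D] at h4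
  rw [hDU, msign_union_right _ hA'T, msign_union_right _ hA'T, ← hDU]
  refine eq_neg_of_add_eq_zero_left ((mul_eq_zero.1 (?_ : msign A' T * _ = 0)).resolve_left
    (msign_ne_zero _ _))
  linear_combination h4

lemma msign_mul_represents_exchange (hm : 1 ≤ m) (hg : WedgeAffine g)
    (hK : ∀ I, Represents r (findiff (bform I) g) (K I)) {B D : Finset (Fin n)} {i j : Fin n}
    (hB : B.card + 1 = m) (hD : D.card + 1 = m * r) (hiB : i ∉ B) (hjB : j ∉ B)
    (hiD : i ∉ D) (hjD : j ∉ D) (hij : i ≠ j) :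
    msign (insert i B) (insert j D) * K (insert i B) (insert j D) =
      msign (insert j B) (insert i D) * K (insert j B) (insert i D) := by
  have h := represents_exchange hm hg hK hB hD hiB hjB hiD hjD
  have diB : Disjoint {i} B := by simpa using hiB
  have djB : Disjoint {j} B := by simpa using hjB
  have diD : Disjoint {i} D := by simpa using hiD
  have djD : Disjoint {j} D := by simpa using hjD
  have h1 : msign ({i} : Finset (Fin n)) {j} = -msign {j} {i} := by
    rw [msign_comm (by simpa using hij)]
    simp
  have hs : msign (insert i B) (insert j D) * (msign {i} B * msign {j} D) =
      -(msign (insert j B) (insert i D) * (msign {j} B * msign {i} D)) := by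
    simp only [Finset.insert_eq]
    rw [msign_union_left diB, msign_union_left djB, msign_union_right _ diD,
      msign_union_right _ diD, msign_union_right _ djD, msign_union_right _ djD, h1,
      msign_comm diB.symm, msign_comm djB.symm]
    simp only [Finset.card_singleton, mul_one]
    ring
  have hP : msign {i} B * msign {j} D * (msign {i} B * msign {j} D) = 1 := by
    rw [mul_mul_mul_comm, msign_mul_self, msign_mul_self, one_mul]
  have hQ : msign {j} B * msign {i} D * (msign {j} B * msign {i} D) = 1 := by
    rw [mul_mul_mul_comm, msign_mul_self, msign_mul_self, one_mul]
  linear_combination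
    -(msign (insert i B) (insert j D) * K (insert i B) (insert j D)) * hP
    + msign (insert i B) (insert j D) * (msign {i} B * msign {j} D) * h
    - msign {j} B * msign {i} D * K (insert j B) (insert i D) * hs
    + msign (insert j B) (insert i D) * K (insert j B) (insert i D) * hQ

lemma msign_mul_represents_sdiff_eq (hm : 1 ≤ m) (hg : WedgeAffine g)
    (hK : ∀ I, Represents r (findiff (bform I) g) (K I)) {S I I' : Finset (Fin n)}
    (hS : S.card = m * (r + 1)) (hIS : I ⊆ S) (hIS' : I' ⊆ S) (hI : I.card = m)
    (hI' : I'.card = m) :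
    msign I (S \ I) * K I (S \ I) = msign I' (S \ I') * K I' (S \ I') := by
  induction hd : (I \ I').card generalizing I with
  | zero =>
    have : I ⊆ I' := Finset.sdiff_eq_empty_iff_subset.1 (Finset.card_eq_zero.1 hd)
    rw [Finset.eq_of_subset_of_card_le this (by rw [hI, hI'])]
  | succ d ih =>
    obtain ⟨i, hi⟩ : (I \ I').Nonempty := Finset.card_pos.1 (by omega)
    have hd' : (I' \ I).card = d + 1 := by
      rw [← hd, Finset.card_sdiff_comm (by rw [hI, hI'])]
    obtain ⟨j, hj⟩ : (I' \ I).Nonempty := Finset.card_pos.1 (by omega)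
    rw [Finset.mem_sdiff] at hi hj
    have hij : i ≠ j := fun e => hj.2 (e ▸ hi.1)
    have hjB : j ∉ I.erase i := fun h => hj.2 (Finset.mem_of_mem_erase h)
    have hIB : insert i (I.erase i) = I := Finset.insert_erase hi.1
    have hB : (I.erase i).card + 1 = m := by rw [Finset.card_erase_add_one hi.1, hI]
    have hjJ : j ∈ S \ I := Finset.mem_sdiff.2 ⟨hIS' hj.1, hj.2⟩
    have hJD : insert j ((S \ I).erase j) = S \ I := Finset.insert_erase hjJ
    have hD : ((S \ I).erase j).card + 1 = m * r := by
      rw [Finset.card_erase_add_one hjJ, Finset.card_sdiff_of_subset hIS, hS, hI, mul_add, mul_one,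
        Nat.add_sub_cancel]
    have hJ : insert i ((S \ I).erase j) = S \ insert j (I.erase i) := by
      ext x
      simp only [Finset.mem_insert, Finset.mem_erase, Finset.mem_sdiff]
      by_cases hxi : x = i
      · subst hxi
        simp [hij, hIS hi.1]
      · simp only [hxi, false_or, not_false_eq_true, true_and, ne_eq]
        tauto
    have hx := msign_mul_represents_exchange hm hg hK hB hD (Finset.notMem_erase i I) hjB
      (by simp [hi.1]) (Finset.notMem_erase j _) hij
    rw [hIB, hJD, hJ] at hx
    rw [hx]
    refine ih (Finset.insert_subset (hIS' hj.1) ((Finset.erase_subset _ _).trans hIS)) ?_ ?_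
    · rw [Finset.card_insert_of_notMem hjB, hB]
    · rw [Finset.insert_sdiff_of_mem _ hj.1, Finset.erase_sdiff_comm,
        Finset.card_erase_of_mem (Finset.mem_sdiff.2 hi), hd, Nat.add_sub_cancel]

end Exchange

lemma WedgeAffine.exists_represents {n m : ℕ} (hm : 1 ≤ m) {g : Lam n m → ℝ} (hg : WedgeAffine g)
    (r : ℕ) : ∃ C, Represents r g C := by
  induction r generalizing g with
  | zero => exact ⟨fun _ => g 0, rfl⟩
  | succ r ih =>
    choose K hK using fun I : Finset (Fin n) => ih (hg.findiff (bform I))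
    classical
    refine ⟨fun S => if h : ∃ I ⊆ S, I.card = m then
      msign h.choose (S \ h.choose) * K h.choose (S \ h.choose) else 0, fun I hI => ?_⟩
    refine (hK I).congr fun J hJ => ?_
    rw [contr_apply]
    by_cases hd : Disjoint I J
    · rw [if_pos hd]
      have h : ∃ I' ⊆ I ∪ J, I'.card = m := ⟨I, Finset.subset_union_left, hI⟩
      have hS : (I ∪ J).card = m * (r + 1) := by
        rw [Finset.card_union_of_disjoint hd, hI, hJ]
        ring
      rw [dif_pos h, msign_mul_represents_sdiff_eq hm hg hK hS h.choose_spec.1 Finset.subset_union_left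
        h.choose_spec.2 hI, Finset.union_sdiff_cancel_left hd, ← mul_assoc, msign_mul_self, one_mul]
    · rw [if_neg hd]
      obtain ⟨j, hjI, hjJ⟩ := Finset.not_disjoint_iff.1 hd
      exact represents_eq_zero_of_mem hm hg hK hI hJ hjI hjJ

/-! ### Taylor expansion -/

/-- The directional derivative operator in direction `ω`, expressed through finite differences
along basis forms. -/
def dirDiff {n m : ℕ} (ω : Lam n m) : Module.End ℝ (Lam n m → ℝ) :=
  ∑ I : Idx n m, ω I • findiff (bform I.1)

lemma dirDiff_apply {n m : ℕ} (ω : Lam n m) (g : Lam n m → ℝ) :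
    dirDiff ω g = ∑ I : Idx n m, ω I • findiff (bform I.1) g := by
  simp [dirDiff]

lemma Represents.dirDiff_pow {n m r : ℕ} {g : Lam n m → ℝ} {C : Finset (Fin n) → ℝ}
    (h : Represents r g C) (ω : Lam n m) :
    (dirDiff ω ^ r) g 0 = ip (fun S => C S.1) (lpow ω r) := by
  rw [← contrForm_apply_empty, contrForm_lpow]
  induction r generalizing g C with
  | zero => exact h
  | succ r ih =>
    simp only [pow_succ, Module.End.mul_apply, dirDiff_apply, contrForm, LinearMap.sum_apply,
      LinearMap.smul_apply, map_sum, map_smul, Finset.sum_apply, Pi.smul_apply]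
    exact Finset.sum_congr rfl fun I _ => congrArg (ω I • ·) (ih (h I.1 I.2))

lemma dirDiff_comp_add {n m : ℕ} (ω x : Lam n m) (g : Lam n m → ℝ) (r : ℕ) (y : Lam n m) :
    (dirDiff ω ^ r) (fun z => g (x + z)) y = (dirDiff ω ^ r) g (x + y) := by
  induction r generalizing y with
  | zero => rfl
  | succ r ih =>
    simp only [pow_succ', Module.End.mul_apply, dirDiff_apply, Finset.sum_apply, Pi.smul_apply,
      findiff_apply, ih, add_assoc]

namespace WedgeAffine

variable {n m : ℕ} {g : Lam n m → ℝ}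

lemma comp_add (hg : WedgeAffine g) (x : Lam n m) : WedgeAffine fun z => g (x + z) := by
  intro a b z t
  simp only [← add_assoc]
  exact hg a b (x + z) t

lemma dirDiff (hg : WedgeAffine g) (ω : Lam n m) : WedgeAffine (dirDiff ω g) := by
  intro a b x t
  simp only [dirDiff_apply, Finset.sum_apply, Pi.smul_apply, smul_eq_mul,
    ← Finset.sum_sub_distrib, Finset.mul_sum, ← Finset.sum_add_distrib,
    fun I : Idx n m => hg.findiff (bform I.1) a b x t]
  exact Finset.sum_congr rfl fun I _ => by ring

lemma dirDiff_pow_eq_zero (hm : 1 ≤ m) (hg : WedgeAffine g) (ω : Lam n m) {r : ℕ}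
    (hr : n < m * r) : (_root_.dirDiff ω ^ r) g = 0 := by
  ext x
  obtain ⟨C, hC⟩ := (hg.comp_add x).exists_represents hm r
  have h := hC.dirDiff_pow ω
  rw [dirDiff_comp_add, add_zero] at h
  rw [h, ip]
  refine Finset.sum_eq_zero fun S _ => ?_
  have h1 := Finset.card_le_univ S.1
  rw [S.2, Fintype.card_fin] at h1
  omega

lemma hasDerivAt_sum (hm : 1 ≤ m) (hg : WedgeAffine g) (ω x : Lam n m) (s : Finset (Idx n m))
    (t : ℝ) :
    HasDerivAt (fun t : ℝ => g (x + t • ∑ I ∈ s, ω I • bform I.1))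
      (∑ I ∈ s, ω I * _root_.findiff (bform I.1) g (x + t • ∑ I ∈ s, ω I • bform I.1)) t := by
  classical
  induction s using Finset.induction_on generalizing g with
  | empty => simpa using hasDerivAt_const t (g x)
  | insert J s hJ ih =>
    have hne : ∀ I : Idx n m, I.1.Nonempty := fun I => Finset.card_pos.1 (by rw [I.2]; exact hm)
    have hline : ∀ {h : Lam n m → ℝ}, WedgeAffine h → ∀ (t : ℝ),
        h (x + t • ∑ I ∈ insert J s, ω I • bform I.1) =
          h (x + t • ∑ I ∈ s, ω I • bform I.1) + t * ω J *
            _root_.findiff (bform J.1) h (x + t • ∑ I ∈ s, ω I • bform I.1) := by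
      intro h hh t
      rw [Finset.sum_insert hJ, smul_add, add_comm (t • ω J • _), ← add_assoc, smul_smul,
        hh.affineAlong_bform (hne J) J.2, findiff_apply]
    simp only [hline hg]
    have h1 := ih hg
    have h2 := ((hasDerivAt_id t).mul_const (ω J)).mul (ih (hg.findiff (bform J.1)))
    refine (h1.add h2).congr_deriv ?_
    obtain ⟨j, hj⟩ := hne J
    simp only [hline (hg.findiff _)]
    simp only [Finset.sum_insert hJ, hg.findiff_bform_bform_of_mem J.2 J.2 hj hj,
      findiff_comm (bform J.1), Pi.zero_apply, id, mul_add, Finset.sum_add_distrib, Finset.mul_sum,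
      one_mul, mul_zero, add_zero]
    rw [add_left_comm]
    congr 2
    exact Finset.sum_congr rfl fun I _ => by ring

lemma hasDerivAt_smul (hm : 1 ≤ m) (hg : WedgeAffine g) (ω : Lam n m) (t : ℝ) :
    HasDerivAt (fun t : ℝ => g (t • ω)) (_root_.dirDiff ω g (t • ω)) t := by
  have hω : ∑ I : Idx n m, ω I • (bform I.1 : Lam n m) = ω := by
    ext J
    rw [Finset.sum_apply, Finset.sum_eq_single J]
    · simp [bform]
    · intro I _ hI
      have : J.1 ≠ I.1 := fun e => hI (Subtype.ext e.symm)
      simp [bform, this]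
    · simp
  have h := hg.hasDerivAt_sum hm ω 0 Finset.univ t
  simp only [hω, zero_add] at h
  simpa [dirDiff_apply] using h

lemma taylor (hm : 1 ≤ m) (hg : WedgeAffine g) (ω : Lam n m) {N : ℕ}
    (hN : (_root_.dirDiff ω ^ N) g = 0) (t : ℝ) :
    g (t • ω) = ∑ r ∈ Finset.range N, t ^ r / (r.factorial : ℝ) * (_root_.dirDiff ω ^ r) g 0 := by
  induction N generalizing g t with
  | zero =>
    have : g = 0 := hN
    simp [this]
  | succ N ih =>
    have hD : ∀ r, (_root_.dirDiff ω ^ r) (_root_.dirDiff ω g) = (_root_.dirDiff ω ^ (r + 1)) g :=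
      fun r => by rw [pow_succ, Module.End.mul_apply]
    have ih' := fun t => ih (hg.dirDiff ω) (by rw [hD, hN]) t
    simp only [hD] at ih'
    have hterm : ∀ r ∈ Finset.range N, ∀ t : ℝ, HasDerivAt
        (fun t : ℝ => t ^ (r + 1) / ((r + 1).factorial : ℝ) * (_root_.dirDiff ω ^ (r + 1)) g 0)
        (t ^ r / (r.factorial : ℝ) * (_root_.dirDiff ω ^ (r + 1)) g 0) t := by
      intro r _ t
      refine (((hasDerivAt_pow (r + 1) t).div_const _).mul_const _).congr_deriv ?_
      rw [Nat.factorial_succ, Nat.add_sub_cancel, Nat.cast_mul,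
        mul_div_mul_left _ _ (by positivity)]
    have hderiv := fun t => (hg.hasDerivAt_smul hm ω t).sub
      (HasDerivAt.fun_sum fun r hr => hterm r hr t)
    have hconst := is_const_of_deriv_eq_zero (fun t => (hderiv t).differentiableAt)
      (fun t => by rw [(hderiv t).deriv, ih', sub_self]) t 0
    have h0 : (_root_.dirDiff ω ^ 0) g 0 = g 0 := rfl
    simp only [Pi.sub_apply, zero_smul, ne_eq, Nat.add_eq_zero_iff, one_ne_zero, and_false,
      not_false_eq_true, zero_pow, zero_div, zero_mul, Finset.sum_const_zero, sub_zero] at hconst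
    rw [Finset.sum_range_succ', h0]
    simp only [pow_zero, Nat.factorial_zero, Nat.cast_one, div_one, one_mul]
    linarith

end WedgeAffine

lemma WedgeAffine.exists_eq_sum_ip_lpow {n m : ℕ} (hm : 1 ≤ m) {g : Lam n m → ℝ}
    (hg : WedgeAffine g) :
    ∃ a : (r : ℕ) → Lam n (m * r), ∀ φ : Lam n m,
      g φ = ∑ r ∈ Finset.range (n / m + 1), ip (a r) (lpow φ r) := by
  choose C hC using hg.exists_represents hm
  refine ⟨fun r S => (r.factorial : ℝ)⁻¹ * C r S.1, fun φ => ?_⟩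
  have h := hg.taylor hm φ (hg.dirDiff_pow_eq_zero hm φ (Nat.lt_mul_div_succ n hm)) 1
  rw [one_smul] at h
  rw [h]
  refine Finset.sum_congr rfl fun r _ => ?_
  rw [(hC r).dirDiff_pow φ]
  simp only [ip, one_pow, one_div, Finset.mul_sum, mul_assoc]

/-! ### Convexity along a line -/

lemma convexOn_univ_add_mul (p q : ℝ) : ConvexOn ℝ Set.univ fun t : ℝ => p + t * q :=
  ⟨convex_univ, fun x _ y _ a b _ _ hab => by
    simp only [smul_eq_mul]
    have : p = a * p + b * p := by rw [← add_mul, hab, one_mul]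
    linarith⟩

lemma eq_add_mul_of_convexOn_of_convexOn_neg {φ : ℝ → ℝ} (h : ConvexOn ℝ Set.univ φ)
    (h' : ConvexOn ℝ Set.univ fun t => -φ t) (t : ℝ) : φ t = φ 0 + t * (φ 1 - φ 0) := by
  have key : ∀ x y a b : ℝ, 0 ≤ a → 0 ≤ b → a + b = 1 → φ (a * x + b * y) = a * φ x + b * φ y := by
    intro x y a b ha hb hab
    have h1 := h.2 (Set.mem_univ x) (Set.mem_univ y) ha hb hab
    have h2 := h'.2 (Set.mem_univ x) (Set.mem_univ y) ha hb hab
    simp only [smul_eq_mul] at h1 h2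
    linarith
  rcases lt_or_ge t 0 with ht | ht
  · have hp : 0 < 1 - t := by linarith
    have h1 := key t 1 (1 / (1 - t)) (-t / (1 - t)) (by positivity)
      (div_nonneg (by linarith) hp.le) (by field_simp; ring)
    rw [show 1 / (1 - t) * t + -t / (1 - t) * 1 = 0 by field_simp; ring] at h1
    field_simp at h1
    linarith
  · rcases le_or_gt t 1 with ht1 | ht1
    · have h1 := key 1 0 t (1 - t) ht (by linarith) (by ring)
      rw [mul_one, mul_zero, add_zero] at h1
      linarith
    · have hp : 0 < t := by linarith
      have h1 := key t 0 (1 / t) ((t - 1) / t) (by positivity)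
        (div_nonneg (by linarith) hp.le) (by field_simp; ring)
      rw [show 1 / t * t + (t - 1) / t * 0 = 1 by field_simp; ring] at h1
      field_simp at h1
      linarith

lemma IntOneAffine.wedgeAffine_comp_hstarInv {n k m : ℕ} {f : Lam n k → ℝ} (hf : IntOneAffine f)
    (h : k + m = n) (hm : 1 ≤ m) : WedgeAffine fun φ : Lam n m => f (hstarInv h φ) := by
  intro a b x t
  have h' : k + 1 + (m - 1) = n := by omega
  simp only [map_add, map_smul, hstarInv_wedge h (by omega : m = 1 + (m - 1)) h']
  have := eq_add_mul_of_convexOn_of_convexOn_neg (hf.1 (hstarInv h x) a _)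
    (hf.2 (hstarInv h x) a ((-1 : ℝ) ^ k • hstarInv h' b)) t
  simpa only [zero_smul, one_smul, add_zero] using this

lemma hstar_add_smul_iprod {n k m : ℕ} (h : k + m = n) (hm : 1 ≤ m) (ω : Lam n k) (a : Lam n 1)
    (b : Lam n (k + 1)) :
    ∃ b' : Lam n (m - 1), ∀ t : ℝ, (hstar (ω + t • (iprod a b : Lam n k)) : Lam n m) =
      hstar ω + t • wedge a b' := by
  have h' : k + 1 + (m - 1) = n := by omega
  refine ⟨hstar ((-1 : ℝ) ^ k • b), fun t => ?_⟩
  have hi := hstarInv_wedge h (by omega : m = 1 + (m - 1)) h' a (hstar ((-1 : ℝ) ^ k • b))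
  rw [hstarInv_hstar, smul_smul, ← mul_pow] at hi
  simp only [mul_neg, mul_one, neg_neg, one_pow, one_smul] at hi
  rw [← hi]
  conv_lhs => rw [← hstarInv_hstar h ω, ← map_smul, ← map_add, hstar_hstarInv]

/-- **Corollary (Characterization of int. one affine functions).**
Let `0 ≤ k ≤ n-1` and `f : Λᵏ → ℝ`.  Then `f` is int. one affine iff there exist
`a_r ∈ Λ^{(n-k)r}` (`r = 0,…,⌊n/(n-k)⌋`) with
`f(ω) = ∑_{r=0}^{⌊n/(n-k)⌋} ⟨a_r; (∗ω)^r⟩` for all `ω ∈ Λᵏ`. -/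
theorem stmt3 {n k : ℕ} (hn : 1 ≤ n) (hkn : k ≤ n - 1) (f : Lam n k → ℝ) :
    IntOneAffine f ↔
      ∃ a : (r : ℕ) → Lam n ((n-k) * r),
        ∀ ω : Lam n k,
          f ω = ∑ r ∈ Finset.range (n / (n-k) + 1), ip (a r) (lpow (hstar ω : Lam n (n-k)) r) := by
  have h : k + (n - k) = n := by omega
  have hm : 1 ≤ n - k := by omega
  constructor
  · intro hf
    obtain ⟨a, ha⟩ := (hf.wedgeAffine_comp_hstarInv h hm).exists_eq_sum_ip_lpow hm
    refine ⟨a, fun ω => ?_⟩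
    rw [← ha, hstarInv_hstar]
  · rintro ⟨c, hc⟩
    have key : ∀ (ω : Lam n k) (a : Lam n 1) (b : Lam n (k + 1)), ∃ q : ℝ, ∀ t : ℝ,
        f (ω + t • (iprod a b : Lam n k)) = f ω + t * q := by
      intro ω a b
      obtain ⟨b', hb'⟩ := hstar_add_smul_iprod h hm ω a b
      choose q hq using fun r => exists_ip_lpow_add_smul_wedge hm (c r) (hstar ω) a b'
      refine ⟨∑ r ∈ Finset.range (n / (n - k) + 1), q r, fun t => ?_⟩
      simp only [hc, hb', hq, Finset.sum_add_distrib, Finset.mul_sum]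
    refine ⟨fun ω a b => ?_, fun ω a b => ?_⟩
    · obtain ⟨q, hq⟩ := key ω a b
      simpa only [hq] using convexOn_univ_add_mul (f ω) q
    · obtain ⟨q, hq⟩ := key ω a b
      simpa only [hq, neg_add, ← mul_neg] using convexOn_univ_add_mul (-f ω) (-q)
end

section
/- Let 1 ≤ k ≤ n−1 and let f : Λ^{k+1} × Λ^{k−1} → ℝ be ext-int. one convex (resp. ext-int. one affine). Then for every fixed η ∈ Λ^{k−1}, the function f_η : Λ^{k+1} → ℝ defined by f_η(ξ) := f(ξ,η) is ext. one convex (resp. ext. one affine). -/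
/-- The matrix of `b ↦ a ∧ b`. -/
def wedgeMatrix {n k m : ℕ} (a : Lam n 1) : Matrix (Idx n m) (Idx n k) ℝ :=
  fun I S => ∑ R : Idx n 1,
    if R.1 ∪ S.1 = I.1 ∧ Disjoint R.1 S.1 then msign R.1 S.1 * a R else 0

theorem wedge_eq_mulVec {n k m : ℕ} (a : Lam n 1) (b : Lam n k) :
    (wedge a b : Lam n m) = (wedgeMatrix a).mulVec b := by
  funext I
  simp only [wedge, wedgeMatrix, Matrix.mulVec, dotProduct, Finset.sum_mul]
  rw [Finset.sum_comm]
  refine Finset.sum_congr rfl fun S _ => Finset.sum_congr rfl fun R _ => ?_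
  split_ifs <;> ring

theorem iprod_eq_transpose_mulVec {n k m : ℕ} (a : Lam n 1) (b : Lam n k) :
    (iprod a b : Lam n m) = (wedgeMatrix a).transpose.mulVec b := by
  funext C
  simp only [iprod, wedgeMatrix, Matrix.mulVec, dotProduct, Matrix.transpose_apply,
    Finset.sum_mul]
  rw [Finset.sum_comm]
  refine Finset.sum_congr rfl fun S _ => Finset.sum_congr rfl fun R _ => ?_
  split_ifs <;> ring

theorem Matrix.exists_mulVec_transpose_mulVec_eq {m n : Type*} [Fintype m] [Fintype n]
    (M : Matrix m n ℝ) (b : n → ℝ) :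
    ∃ c : m → ℝ, M.mulVec (M.transpose.mulVec c) = M.mulVec b := by
  classical
  have hle : LinearMap.range (M * M.transpose).mulVecLin ≤ LinearMap.range M.mulVecLin := by
    rw [Matrix.mulVecLin_mul]
    exact LinearMap.range_comp_le_range _ _
  have heq := Submodule.eq_of_le_of_finrank_eq hle (Matrix.rank_self_mul_transpose M)
  have hb : M.mulVecLin b ∈ LinearMap.range (M * M.transpose).mulVecLin :=
    heq ▸ LinearMap.mem_range_self _ b
  obtain ⟨c, hc⟩ := hb
  exact ⟨c, by rw [Matrix.mulVec_mulVec]; exact hc⟩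

/-- Coordinates of a form, indexed by all finite sets and extended by zero. -/
def Lam.coord {n k : ℕ} (b : Lam n k) (S : Finset (Fin n)) : ℝ :=
  if h : S.card = k then b ⟨S, h⟩ else 0

theorem iprod_apply {n k m : ℕ} (a : Lam n 1) (b : Lam n k) (C : Idx n m) :
    (iprod a b : Lam n m) C = ∑ i : Fin n, if i ∉ C.1 then
      msign {i} C.1 * (a.coord {i} * b.coord (insert i C.1)) else 0 := by
  have hbij : Function.Bijective
      (fun i : Fin n => (⟨{i}, Finset.card_singleton i⟩ : Idx n 1)) := by
    constructor
    · intro i j h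
      simpa using h
    · rintro ⟨s, hs⟩
      obtain ⟨i, rfl⟩ := Finset.card_eq_one.mp hs
      exact ⟨i, rfl⟩
  rw [iprod, ← hbij.sum_comp]
  refine Finset.sum_congr rfl fun i _ => ?_
  by_cases hi : i ∈ C.1
  · simp [hi]
  · by_cases h : (insert i C.1).card = k
    · rw [Finset.sum_eq_single (⟨insert i C.1, h⟩ : Idx n k)]
      · simp [hi, Lam.coord, h]
      · rintro ⟨B, hB⟩ _ hne
        rw [if_neg]
        rintro ⟨rfl, -⟩
        exact hne rfl
      · simp
    · rw [Finset.sum_eq_zero]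
      · simp [Lam.coord, h]
      · rintro ⟨B, hB⟩ _
        rw [if_neg]
        rintro ⟨rfl, -⟩
        exact h hB

theorem msign_singleton_insert {n : ℕ} {i j : Fin n} {D : Finset (Fin n)} (hi : i ∉ D) :
    msign {j} (insert i D) = (if i < j then -1 else 1) * msign {j} D := by
  have key : ∀ S : Finset (Fin n), msign {j} S = ∏ d ∈ S, if d < j then (-1 : ℝ) else 1 := by
    intro S
    rw [Finset.prod_ite, Finset.prod_const, Finset.prod_const_one, mul_one, msign,
      Finset.singleton_product, Finset.filter_map, Finset.card_map]
    rfl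
  rw [key, key, Finset.prod_insert hi]

theorem iprod_iprod_self {n k : ℕ} (a : Lam n 1) (c : Lam n (k + 2)) :
    (iprod a (iprod a c : Lam n (k + 1)) : Lam n k) = 0 := by
  funext D
  have h : (iprod a (iprod a c : Lam n (k + 1)) : Lam n k) D =
      ∑ i : Fin n, ∑ j : Fin n, if i ∉ D.1 ∧ j ∉ D.1 ∧ i ≠ j then
        (if i < j then -1 else 1) * (msign {i} D.1 * msign {j} D.1 *
          (a.coord {i} * a.coord {j}) * c.coord (insert j (insert i D.1))) else 0 := by
    rw [iprod_apply]
    refine Finset.sum_congr rfl fun i _ => ?_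
    by_cases hi : i ∈ D.1
    · simp [hi]
    · have hcard : (insert i D.1).card = k + 1 := by
        rw [Finset.card_insert_of_notMem hi, D.2]
      rw [if_pos hi, Lam.coord, Lam.coord, dif_pos hcard, iprod_apply, Finset.mul_sum,
        Finset.mul_sum]
      refine Finset.sum_congr rfl fun j _ => ?_
      rw [msign_singleton_insert hi]
      by_cases hj : j ∈ D.1
      · simp [hj]
      · by_cases hij : i = j
        · simp [hij]
        · simp [hi, hj, hij, Ne.symm hij, Lam.coord]
          split_ifs <;> ring
  have hneg : (iprod a (iprod a c : Lam n (k + 1)) : Lam n k) D =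
      -(iprod a (iprod a c : Lam n (k + 1)) : Lam n k) D := by
    conv_rhs => rw [h, Finset.sum_comm]
    rw [h, ← Finset.sum_neg_distrib]
    refine Finset.sum_congr rfl fun i _ => ?_
    rw [← Finset.sum_neg_distrib]
    refine Finset.sum_congr rfl fun j _ => ?_
    rw [Finset.insert_comm]
    rcases lt_trichotomy i j with hij | rfl | hij
    · simp only [hij, hij.not_gt, if_true, if_false]
      split_ifs <;> first | (exfalso; tauto) | ring
    · simp
    · simp only [hij, hij.not_gt, if_true, if_false]
      split_ifs <;> first | (exfalso; tauto) | ring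
  simpa using (self_eq_neg.mp hneg)

theorem exists_wedge_eq_iprod_eq_zero {n k : ℕ} (a : Lam n 1) (b : Lam n (k + 1)) :
    ∃ b' : Lam n (k + 1), (wedge a b' : Lam n (k + 2)) = wedge a b ∧
      (iprod a b' : Lam n k) = 0 := by
  obtain ⟨c, hc⟩ := (wedgeMatrix a : Matrix (Idx n (k + 2)) (Idx n (k + 1)) ℝ)
    |>.exists_mulVec_transpose_mulVec_eq b
  refine ⟨iprod a c, ?_, iprod_iprod_self a c⟩
  rw [wedge_eq_mulVec, wedge_eq_mulVec, iprod_eq_transpose_mulVec, hc]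

theorem ExtIntOneConvex.extOneConvex {n k : ℕ} (hk : 1 ≤ k)
    {f : Lam n (k+1) → Lam n (k-1) → ℝ} (hf : ExtIntOneConvex f) (η : Lam n (k-1)) :
    ExtOneConvex (fun ξ => f ξ η) := by
  obtain ⟨k, rfl⟩ := Nat.exists_eq_add_of_le' hk
  intro ξ a b
  obtain ⟨b', hw, hi⟩ := exists_wedge_eq_iprod_eq_zero a b
  have hi' : (iprod a b' : Lam n (k + 1 - 1)) = 0 := hi
  have h := hf ξ η a b'
  rw [hw, hi'] at h
  simpa only [smul_zero, add_zero] using h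

/-- **Lemma.** Let `1 ≤ k ≤ n-1` and let `f : Λ^{k+1} × Λ^{k-1} → ℝ` be
ext-int. one convex (resp. ext-int. one affine).  Then for every `η ∈ Λ^{k-1}`,
the function `ξ ↦ f(ξ,η)` is ext. one convex (resp. ext. one affine). -/
theorem stmt7 {n k : ℕ} (hk : 1 ≤ k) (hkn : k ≤ n - 1)
    (f : Lam n (k+1) → Lam n (k-1) → ℝ) :
    (ExtIntOneConvex f → ∀ η : Lam n (k-1), ExtOneConvex (fun ξ => f ξ η)) ∧
    (ExtIntOneAffine f → ∀ η : Lam n (k-1), ExtOneAffine (fun ξ => f ξ η)) :=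
  ⟨fun hf η => hf.extOneConvex hk η,
    fun hf η => ⟨hf.1.extOneConvex hk η, hf.2.extOneConvex hk η⟩⟩
end

section
/- Let n = 2, k = 1, and define f : Λ^2(ℝ^2) × ℝ → ℝ by f(ξ,η) := (∗ξ)·η. Then for every ξ ∈ Λ^2 the map η ↦ f(ξ,η) is affine and for every η ∈ ℝ the map ξ ↦ f(ξ,η) is affine, yet f is not ext-int. one convex. In particular, the converse of the statement 'ext-int. one convexity implies separate ext. one convexity and int. one convexity' is false. -/
theorem sum_idx_two_zero (g : Idx 2 0 → ℝ) : ∑ I, g I = g ⟨∅, rfl⟩ := by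
  have h : (Finset.univ : Finset (Idx 2 0)) = {⟨∅, rfl⟩} := by decide
  rw [h, Finset.sum_singleton]

theorem sum_idx_two_one (g : Idx 2 1 → ℝ) : ∑ I, g I = g ⟨{0}, rfl⟩ + g ⟨{1}, rfl⟩ := by
  have h : (Finset.univ : Finset (Idx 2 1)) = {⟨{0}, rfl⟩, ⟨{1}, rfl⟩} := by decide
  rw [h, Finset.sum_pair (by decide)]

theorem sum_idx_two_two (g : Idx 2 2 → ℝ) : ∑ I, g I = g ⟨Finset.univ, rfl⟩ := by
  have h : (Finset.univ : Finset (Idx 2 2)) = {⟨Finset.univ, rfl⟩} := by decide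
  rw [h, Finset.sum_singleton]

theorem msign_empty_right {n : ℕ} (R : Finset (Fin n)) : msign R ∅ = 1 := by
  simp [msign]

theorem ip_hstar_two_two (ξ : Lam 2 2) (η : Lam 2 0) :
    ip (hstar ξ : Lam 2 0) η = ξ ⟨Finset.univ, rfl⟩ * η ⟨∅, rfl⟩ := by
  simp [ip, hstar, sum_idx_two_zero, sum_idx_two_two, msign_empty_right]

theorem wedge_two_one_one (a b : Lam 2 1) :
    (wedge a b : Lam 2 2) ⟨Finset.univ, rfl⟩ =
      a ⟨{0}, rfl⟩ * b ⟨{1}, rfl⟩ - a ⟨{1}, rfl⟩ * b ⟨{0}, rfl⟩ := by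
  have h01 : ({0, 1} : Finset (Fin 2)) = Finset.univ := by decide
  have h10 : ({1, 0} : Finset (Fin 2)) = Finset.univ := by decide
  simp [wedge, sum_idx_two_one, msign, h01, h10, Finset.filter_singleton, sub_eq_add_neg]

theorem iprod_two_one_one (a b : Lam 2 1) :
    (iprod a b : Lam 2 0) ⟨∅, rfl⟩ =
      a ⟨{0}, rfl⟩ * b ⟨{0}, rfl⟩ + a ⟨{1}, rfl⟩ * b ⟨{1}, rfl⟩ := by
  simp [iprod, sum_idx_two_one, msign_empty_right]

/-- **Counterexample (`n = 2`, `k = 1`).** The function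
`f(ξ,η) := (∗ξ)·η` on `Λ²(ℝ²) × Λ⁰(ℝ²)` is separately affine in each variable, yet it is
not ext-int. one convex: the converse of Lemma `corollary of crucial lemma` is false. -/
theorem stmt9 (f : Lam 2 2 → Lam 2 0 → ℝ)
    (hf : ∀ (ξ : Lam 2 2) (η : Lam 2 0), f ξ η = ip (hstar ξ : Lam 2 0) η) :
    (∀ ξ : Lam 2 2, AffineFn (fun η => f ξ η)) ∧
    (∀ η : Lam 2 0, AffineFn (fun ξ => f ξ η)) ∧
    ¬ ExtIntOneConvex (n := 2) (k := 1) f := by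
  refine ⟨fun ξ => ⟨0, hstar ξ, fun η => by simp [hf]⟩,
    fun η => ⟨0, fun _ => η ⟨∅, rfl⟩, fun ξ => ?_⟩, fun h => ?_⟩
  · simp only [hf, ip_hstar_two_two]
    simp [ip, sum_idx_two_two, mul_comm]
  · let a : Lam 2 1 := bform {0}
    let b : Lam 2 1 := bform {0} - bform {1}
    have hw : (wedge a b : Lam 2 2) ⟨Finset.univ, rfl⟩ = -1 := by
      simp [wedge_two_one_one, a, b, bform]
    have hi : (iprod a b : Lam 2 0) ⟨∅, rfl⟩ = 1 := by
      simp [iprod_two_one_one, a, b, bform]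
    have key (t : ℝ) : f (0 + t • (wedge a b : Lam 2 2)) (0 + t • (iprod a b : Lam 2 0))
        = -(t * t) := by
      rw [hf, ip_hstar_two_two]
      simp [hw, hi]
    have hc : ConvexOn ℝ Set.univ (fun t : ℝ => -(t * t)) := funext key ▸ h 0 0 a b
    have := hc.2 (Set.mem_univ (-1)) (Set.mem_univ 1)
      (by norm_num : (0 : ℝ) ≤ 1 / 2) (by norm_num : (0 : ℝ) ≤ 1 / 2) (by norm_num)
    norm_num at this
end
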